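/- Every tetromino fence whose union is contained in a 6 × 5 rectangle of cells has at least 3 of its 20 cells lying strictly inside that rectangle (i.e., in the interior 4 × 3 subrectangle), and hence its enclosed area is at most 9. -/

import Mathlib

/-- Cells of the square lattice. -/
abbrev Cell : Type := ℤ × ℤ

/-- Two cells are adjacent if they differ by (±1,0) or (0,±1). -/
def Adj (p q : Cell) : Prop := (p.1 - q.1).natAbs + (p.2 - q.2).natAbs = 1

/-- `q` is reachable from `p` by a path of adjacent cells inside `S`. -/
def ReachIn (S : Set Cell) (p q : Cell) : Prop :=
  Relation.ReflTransGen (fun x y => Adj x y ∧ x ∈ S ∧ y ∈ S) p q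

/-- A set of cells is connected if any two of its cells are joined by a path
of adjacent cells inside the set. -/
def SetConnected (S : Set Cell) : Prop := ∀ p ∈ S, ∀ q ∈ S, ReachIn S p q

/-- The connected component of `c` in `S` under adjacency. -/
def component (S : Set Cell) (c : Cell) : Set Cell := {d | ReachIn S c d}

/-- A cell `c ∉ F` is enclosed by `F` if its connected component in the
complement of `F` is finite. -/
def Enclosed (F : Set Cell) (c : Cell) : Prop := c ∉ F ∧ (component Fᶜ c).Finite

/-- The enclosed area of `F` is the number of cells enclosed by `F`. -/
noncomputable def encArea (F : Set Cell) : ℕ := Set.ncard {c | Enclosed F c}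

/-- The eight symmetries of the square lattice (rotations by multiples of 90°
and reflections). -/
def symms : List (Cell → Cell) :=
  [fun p => (p.1, p.2), fun p => (-p.2, p.1), fun p => (-p.1, -p.2), fun p => (p.2, -p.1),
   fun p => (p.1, -p.2), fun p => (-p.1, p.2), fun p => (p.2, p.1), fun p => (-p.2, -p.1)]

/-- `Q` is a placement of the polyomino `P`: the image of `P` under a composition
of one of the eight symmetries of the square lattice with a translation. -/
def IsPlacement (P Q : Set Cell) : Prop :=
  ∃ f ∈ symms, ∃ t : Cell, Q = (fun c => f c + t) '' P

/-- Two pieces are edge-adjacent if some cell of one is adjacent to a cell of the other. -/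
def PieceAdj (A B : Set Cell) : Prop := ∃ a ∈ A, ∃ b ∈ B, Adj a b

/-- The five free tetrominoes I, L, N, O, T. -/
def tets : Fin 5 → Set Cell :=
  ![{(0,0), (0,1), (0,2), (0,3)},
    {(0,0), (1,0), (0,1), (0,2)},
    {(0,0), (1,0), (1,1), (2,1)},
    {(0,0), (1,0), (0,1), (1,1)},
    {(0,0), (1,0), (2,0), (1,1)}]

/-- A tetromino fence: five pairwise disjoint placements, one of each free
tetromino, whose union is connected, each piece being edge-adjacent to at
least two of the other pieces. -/
structure TetFence where
  piece : Fin 5 → Set Cell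
  placement : ∀ i, IsPlacement (tets i) (piece i)
  disj : Pairwise fun i j => Disjoint (piece i) (piece j)
  conn : SetConnected (⋃ i, piece i)
  adj2 : ∀ i, 2 ≤ Set.ncard {j | j ≠ i ∧ PieceAdj (piece i) (piece j)}

/-- The enclosed area of a tetromino fence. -/
noncomputable def TetFence.area (F : TetFence) : ℕ := encArea (⋃ i, F.piece i)

/-- A cell from which a straight ray avoids `F` is not enclosed. -/
lemma not_enclosed_of_ray (F : Set Cell) (p : Cell) (u v : ℤ)
    (huv : u.natAbs + v.natAbs = 1)
    (h : ∀ n : ℕ, (p.1 + n * u, p.2 + n * v) ∉ F) : ¬ Enclosed F p := by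
  rintro ⟨-, hfin⟩
  have hreach : ∀ n : ℕ, ReachIn Fᶜ p (p.1 + n * u, p.2 + n * v) := by
    intro n
    induction n with
    | zero => 
      have hz : (p.1 + ((0 : ℕ) : ℤ) * u, p.2 + ((0 : ℕ) : ℤ) * v) = p := by simp
      rw [hz]
      exact Relation.ReflTransGen.refl
    | succ k ih =>
      refine Relation.ReflTransGen.tail ih ⟨?_, h k, h (k + 1)⟩
      have h1 : p.1 + (k : ℤ) * u - (p.1 + ((k + 1 : ℕ) : ℤ) * u) = -u := by push_cast; ring
      have h2 : p.2 + (k : ℤ) * v - (p.2 + ((k + 1 : ℕ) : ℤ) * v) = -v := by push_cast; ring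
      simp only [Adj, h1, h2, Int.natAbs_neg, huv]
  refine Set.infinite_of_injective_forall_mem (f := fun n : ℕ => (p.1 + n * u, p.2 + n * v))
    ?_ hreach hfin
  intro m n hmn
  simp only [Prod.mk.injEq, add_right_inj, mul_eq_mul_right_iff, Nat.cast_inj] at hmn
  omega

set_option maxHeartbeats 4000000 in
/-- A placement of N, O or T inside the rectangle has a cell strictly inside. -/
lemma exists_interior (i : Fin 5) (hi : 2 ≤ i) (Q : Set Cell) (hQ : IsPlacement (tets i) Q)
    (a c : ℤ) (hsub : ∀ p ∈ Q, a ≤ p.1 ∧ p.1 ≤ a + 5 ∧ c ≤ p.2 ∧ p.2 ≤ c + 4) :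
    ∃ p ∈ Q, a + 1 ≤ p.1 ∧ p.1 ≤ a + 4 ∧ c + 1 ≤ p.2 ∧ p.2 ≤ c + 3 := by
  obtain ⟨f, hf, ⟨x, y⟩, rfl⟩ := hQ
  rw [Set.forall_mem_image] at hsub
  rw [Set.exists_mem_image]
  simp only [symms, List.mem_cons, List.not_mem_nil, or_false] at hf
  fin_cases i
  · exact absurd hi (by decide)
  · exact absurd hi (by decide)
  all_goals
    rcases hf with rfl | rfl | rfl | rfl | rfl | rfl | rfl | rfl <;>
    · simp [tets] at hsub ⊢
      omega

/-- Every tetromino fence whose union is contained in the 6 × 5 rectangle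
`{a,…,a+5} × {c,…,c+4}` has at least 3 of its 20 cells lying strictly inside
that rectangle, and hence its enclosed area is at most 9. -/
theorem tetromino_fence_in_6x5 (F : TetFence) (a c : ℤ)
    (hsub : (⋃ i, F.piece i) ⊆
      {p : Cell | a ≤ p.1 ∧ p.1 ≤ a + 5 ∧ c ≤ p.2 ∧ p.2 ≤ c + 4}) :
    3 ≤ Set.ncard {p ∈ ⋃ i, F.piece i |
        a + 1 ≤ p.1 ∧ p.1 ≤ a + 4 ∧ c + 1 ≤ p.2 ∧ p.2 ≤ c + 3} ∧
    F.area ≤ 9 := by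
  classical
  set U := ⋃ i, F.piece i with hU
  set R : Set Cell := {p | a + 1 ≤ p.1 ∧ p.1 ≤ a + 4 ∧ c + 1 ≤ p.2 ∧ p.2 ≤ c + 3} with hR
  have hRe : R = ((Finset.Icc (a + 1) (a + 4) ×ˢ Finset.Icc (c + 1) (c + 3) : Finset Cell) :
      Set Cell) := by
    ext p; simp only [hR, Set.mem_ofPred_eq, Finset.mem_coe, Finset.mem_product, Finset.mem_Icc]; tauto
  have hRfin : R.Finite := by rw [hRe]; exact Finset.finite_toSet _
  have hRcard : R.ncard = 12 := by
    rw [hRe, Set.ncard_coe_finset, Finset.card_product, Int.card_Icc, Int.card_Icc]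
    have h1 : (a + 4 + 1 - (a + 1)).toNat = 4 := by omega
    have h2 : (c + 3 + 1 - (c + 1)).toNat = 3 := by omega
    rw [h1, h2]
  have hex : ∀ i : Fin 5, 2 ≤ i → ∃ p ∈ F.piece i, p ∈ R := fun i hi =>
    exists_interior i hi _ (F.placement i) a c
      (fun p hp => hsub (Set.mem_iUnion.2 ⟨i, hp⟩))
  have hne : ∀ i j, i ≠ j → ∀ p ∈ F.piece i, ∀ q ∈ F.piece j, p ≠ q :=
    fun i j hij p hp q hq hpq => Set.disjoint_left.1 (F.disj hij) hp (hpq ▸ hq)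
  have hset : {p ∈ U | a + 1 ≤ p.1 ∧ p.1 ≤ a + 4 ∧ c + 1 ≤ p.2 ∧ p.2 ≤ c + 3} = U ∩ R := rfl
  have hmain : 3 ≤ (U ∩ R).ncard := by
    obtain ⟨p, hp, hpR⟩ := hex 2 (by decide)
    obtain ⟨q, hq, hqR⟩ := hex 3 (by decide)
    obtain ⟨r, hr, hrR⟩ := hex 4 (by decide)
    have h3 : ({p, q, r} : Set Cell).ncard = 3 := by
      rw [Set.ncard_eq_three]
      exact ⟨p, q, r, hne 2 3 (by decide) p hp q hq, hne 2 4 (by decide) p hp r hr,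
        hne 3 4 (by decide) q hq r hr, rfl⟩
    rw [← h3]
    refine Set.ncard_le_ncard ?_ (hRfin.subset Set.inter_subset_right)
    rintro x (rfl | rfl | rfl)
    · exact ⟨Set.mem_iUnion.2 ⟨2, hp⟩, hpR⟩
    · exact ⟨Set.mem_iUnion.2 ⟨3, hq⟩, hqR⟩
    · exact ⟨Set.mem_iUnion.2 ⟨4, hr⟩, hrR⟩
  refine ⟨hset ▸ hmain, ?_⟩
  have henc : {p | Enclosed U p} ⊆ R \ U := by
    intro p hp
    have hpU : p ∉ U := hp.1
    refine ⟨?_, hpU⟩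
    have key : ∀ u v : ℤ, u.natAbs + v.natAbs = 1 →
        (∀ n : ℕ, 1 ≤ n → (p.1 + n * u, p.2 + n * v) ∉ U) → False := by
      intro u v huv hray
      refine not_enclosed_of_ray U p u v huv ?_ hp
      intro n
      rcases Nat.eq_zero_or_pos n with rfl | hn
      · simpa using hpU
      · exact hray n hn
    refine ⟨?_, ?_, ?_, ?_⟩ <;> by_contra hlt
    · refine key (-1) 0 rfl fun n hn hm => ?_
      have := hsub hm
      simp only [Set.mem_ofPred_eq] at this
      omega
    · refine key 1 0 rfl fun n hn hm => ?_
      have := hsub hm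
      simp only [Set.mem_ofPred_eq] at this
      omega
    · refine key 0 (-1) rfl fun n hn hm => ?_
      have := hsub hm
      simp only [Set.mem_ofPred_eq] at this
      omega
    · refine key 0 1 rfl fun n hn hm => ?_
      have := hsub hm
      simp only [Set.mem_ofPred_eq] at this
      omega
  have hle : F.area ≤ (R \ U).ncard :=
    Set.ncard_le_ncard henc (hRfin.subset Set.sdiff_subset)
  have hsum := Set.ncard_inter_add_ncard_sdiff_eq_ncard R U hRfin
  rw [Set.inter_comm] at hsum
  omega
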